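/- (Theorem 3.4) Define, for μ ∈ (e(t₂), e(t₁)), a_μ = inf{ t ≥ 0 : e(t) ≤ μ }, and for h > 0 the function g_h(μ) = μ − e(a_μ − h). Then for all sufficiently small h > 0 the function g_h possesses a minimum point μ_R(h) in (e(t₂), e(t₁)) characterized by a_{μ_R(h)} = a(h), where a(h) is the unique point in (t₁ + h, t₂) with e′(a(h) − h) = e′(a(h)); and μ_R(h) = e(a(h)) → e(s) as h → 0. In other words, the stochastic resonance point is μ_R = e(s). -/

import Mathlib

open Set Filter Topology

/-- The transition time `a_μ = inf{ t ≥ 0 : e(t) ≤ μ }`. -/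
noncomputable def aTime (e : ℝ → ℝ) (μ : ℝ) : ℝ :=
  sInf {t : ℝ | 0 ≤ t ∧ e t ≤ μ}

/-- If `d` vanishes at both ends of `[t₁, t₂]`, decreases on `[t₁, s]` and increases on `[s, t₂]`,
then `d < 0` on `(t₁, t₂)`. -/
theorem neg_of_strictAntiOn_of_strictMonoOn {d : ℝ → ℝ} {t₁ t₂ s : ℝ} (hs : s ∈ Ioo t₁ t₂)
    (h₁ : d t₁ = 0) (h₂ : d t₂ = 0) (hanti : StrictAntiOn d (Icc t₁ s))
    (hmono : StrictMonoOn d (Icc s t₂)) {u : ℝ} (hu : u ∈ Ioo t₁ t₂) : d u < 0 := by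
  rcases le_total u s with hus | hus
  · exact h₁ ▸ hanti ⟨le_rfl, hs.1.le⟩ ⟨hu.1.le, hus⟩ hu.1
  · exact h₂ ▸ hmono ⟨hus, hu.2.le⟩ ⟨hs.2.le, le_rfl⟩ hu.2

theorem hasDerivAt_sub_shift {e : ℝ → ℝ} (he : Differentiable ℝ e) (h a : ℝ) :
    HasDerivAt (fun u => e u - e (u - h)) (deriv e a - deriv e (a - h)) a :=
  (he a).hasDerivAt.sub ((he (a - h)).hasDerivAt.comp_sub_const a h)

/-- A minimizer over `(t₁, t₂)` of the increment `a ↦ e a - e (a - h)` is a point where `deriv e` takes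
equal values at `a - h` and `a`, and these two points lie on either side of `s`. -/
theorem increment_minimizer_spec {e : ℝ → ℝ} (he : Differentiable ℝ e) {t₁ t₂ s h a : ℝ}
    (hs : s ∈ Ioo t₁ t₂) (hmax : ∀ t, e t ≤ e t₁)
    (hanti : StrictAntiOn (deriv e) (Icc t₁ s)) (hmono : StrictMonoOn (deriv e) (Icc s t₂))
    (heanti : StrictAntiOn e (Icc t₁ t₂))
    (h0 : 0 < h) (hh₁ : h < s - t₁) (ha : a ∈ Ioo t₁ t₂)
    (hmin : ∀ b ∈ Ioo t₁ t₂, e a - e (a - h) ≤ e b - e (b - h)) :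
    t₁ + h < a ∧ deriv e (a - h) = deriv e a ∧ s < a ∧ a < s + h := by
  obtain ⟨hs1, hs2⟩ := hs
  obtain ⟨ha1, ha2⟩ := ha
  have hlocal : IsLocalMin (fun u => e u - e (u - h)) a := by
    filter_upwards [Ioo_mem_nhds ha1 ha2] with b hb using hmin b hb
  have hcrit : deriv e (a - h) = deriv e a := by
    have := hlocal.hasDerivAt_eq_zero (hasDerivAt_sub_shift he h a)
    linarith
  have hlt : t₁ + h < a := by
    by_contra! hle
    rcases hle.lt_or_eq with hlt | rfl
    · have h1 := hmin (t₁ + h) ⟨by linarith, by linarith⟩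
      have h2 := heanti ⟨ha1.le, ha2.le⟩ ⟨by linarith, by linarith⟩ hlt
      have h3 := hmax (a - h)
      rw [add_sub_cancel_right] at h1
      linarith
    · rw [add_sub_cancel_right] at hcrit
      have := hanti ⟨le_rfl, hs1.le⟩ ⟨ha1.le, by linarith⟩ ha1
      linarith
  refine ⟨hlt, hcrit, ?_, ?_⟩
  · by_contra! hle
    have := hanti (a := a - h) (b := a) ⟨by linarith, by linarith⟩ ⟨ha1.le, hle⟩ (by linarith)
    linarith
  · by_contra! hle
    have := hmono (a := a - h) (b := a) ⟨by linarith, by linarith⟩ ⟨by linarith, ha2.le⟩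
      (by linarith)
    linarith

/-- For small `h > 0` the increment `a ↦ e a - e (a - h)` attains its minimum over `(t₁, t₂)`. -/
theorem exists_increment_minimizer {e : ℝ → ℝ} (he : Differentiable ℝ e) {t₁ t₂ s h : ℝ}
    (hs : s ∈ Ioo t₁ t₂) (hmax : ∀ t, e t ≤ e t₁)
    (hmono : StrictMonoOn (deriv e) (Icc s t₂)) (heanti : StrictAntiOn e (Icc t₁ t₂))
    (h0 : 0 < h) (hh₁ : h < s - t₁) (hh₂ : h < t₂ - s) :
    ∃ a ∈ Ioo t₁ t₂, ∀ b ∈ Ioo t₁ t₂, e a - e (a - h) ≤ e b - e (b - h) := by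
  obtain ⟨hs1, hs2⟩ := hs
  have hcont : Continuous fun u => e u - e (u - h) :=
    he.continuous.sub (he.continuous.comp (continuous_sub_right h))
  obtain ⟨a, ha, hamin⟩ := isCompact_Icc.exists_isMinOn
    (nonempty_Icc.2 (hs1.trans hs2).le) hcont.continuousOn
  have hle : ∀ b ∈ Icc t₁ t₂, e a - e (a - h) ≤ e b - e (b - h) := fun b hb => hamin hb
  refine ⟨a, ⟨lt_of_le_of_ne ha.1 ?_, lt_of_le_of_ne ha.2 ?_⟩,
    fun b hb => hle b (Ioo_subset_Icc_self hb)⟩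
  · rintro rfl
    have h1 := hle s ⟨hs1.le, hs2.le⟩
    have h2 := heanti (a := s - h) (b := s) ⟨by linarith, by linarith⟩ ⟨hs1.le, hs2.le⟩
      (by linarith)
    have h3 := hmax (t₁ - h)
    linarith
  · rintro rfl
    have hG : StrictMonoOn (fun u => e u - e (u - h)) (Icc (s + h) a) := by
      refine strictMonoOn_of_deriv_pos (convex_Icc _ _) hcont.continuousOn fun u hu => ?_
      rw [interior_Icc] at hu
      rw [(hasDerivAt_sub_shift he h u).deriv]
      exact sub_pos.2 (hmono ⟨by linarith [hu.1], by linarith [hu.2]⟩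
        ⟨by linarith [hu.1], hu.2.le⟩ (by linarith))
    have h1 : e (s + h) - e (s + h - h) < e a - e (a - h) :=
      hG ⟨le_rfl, by linarith⟩ ⟨by linarith, le_rfl⟩ (by linarith)
    have h2 := hle (s + h) ⟨by linarith, by linarith⟩
    linarith

/-- Theorem 3.4: for small `h > 0` the function
`g_h(μ) = μ − e(a_μ − h)` has a minimizer `μ_R(h)` on `(e(t₂), e(t₁))` characterized by
`e′(a_{μ_R(h)} − h) = e′(a_{μ_R(h)})`, and `μ_R(h) = e(a(h)) → e(s)` as `h → 0`:
the stochastic resonance point is `μ_R = e(s)`. -/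
theorem stochastic_resonance_point (e : ℝ → ℝ)
    (hper : ∀ t, e (t + 1) = e t)
    (hC2 : ContDiff ℝ 2 e)
    (t₁ t₂ : ℝ) (ht₁ : 0 ≤ t₁) (h12 : t₁ < t₂) (h21 : t₂ < t₁ + 1)
    (hmax : ∀ t, e t ≤ e t₁) (hmin : ∀ t, e t₂ ≤ e t)
    (hdec : StrictAntiOn e (Ioo t₁ t₂))
    (s : ℝ) (hs : s ∈ Ioo t₁ t₂)
    (hconc : ∀ u ∈ Ioo t₁ s, deriv (deriv e) u < 0)
    (hconv : ∀ u ∈ Ioo s t₂, 0 < deriv (deriv e) u)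
    (hinv : ∀ μ ∈ Ioo (e t₂) (e t₁),
      aTime e μ ∈ Icc t₁ t₂ ∧ e (aTime e μ) = μ) :
    (∃ h₀ > (0:ℝ), ∀ h : ℝ, 0 < h → h ≤ h₀ →
      ∃ μR ∈ Ioo (e t₂) (e t₁),
        (∀ μ ∈ Ioo (e t₂) (e t₁),
          μR - e (aTime e μR - h) ≤ μ - e (aTime e μ - h)) ∧
        aTime e μR ∈ Ioo (t₁ + h) t₂ ∧
        deriv e (aTime e μR - h) = deriv e (aTime e μR) ∧
        μR = e (aTime e μR)) ∧
    (∀ ε > (0:ℝ), ∃ h₁ > (0:ℝ), ∀ h : ℝ, 0 < h → h < h₁ →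
      ∀ μR ∈ Ioo (e t₂) (e t₁),
        (∀ μ ∈ Ioo (e t₂) (e t₁),
          μR - e (aTime e μR - h) ≤ μ - e (aTime e μ - h)) →
        |μR - e s| < ε) := by
  have he : Differentiable ℝ e := hC2.differentiable (by norm_num)
  have hcd : Continuous (deriv e) := hC2.continuous_deriv (by norm_num)
  have hd₁ : deriv e t₁ = 0 := IsLocalMax.deriv_eq_zero (Eventually.of_forall hmax)
  have hd₂ : deriv e t₂ = 0 := IsLocalMin.deriv_eq_zero (Eventually.of_forall hmin)
  have hanti : StrictAntiOn (deriv e) (Icc t₁ s) :=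
    strictAntiOn_of_deriv_neg (convex_Icc _ _) hcd.continuousOn
      fun u hu => hconc u (by rwa [interior_Icc] at hu)
  have hmono : StrictMonoOn (deriv e) (Icc s t₂) :=
    strictMonoOn_of_deriv_pos (convex_Icc _ _) hcd.continuousOn
      fun u hu => hconv u (by rwa [interior_Icc] at hu)
  have heanti : StrictAntiOn e (Icc t₁ t₂) :=
    strictAntiOn_of_deriv_neg (convex_Icc _ _) he.continuous.continuousOn fun u hu =>
      neg_of_strictAntiOn_of_strictMonoOn hs hd₁ hd₂ hanti hmono (by rwa [interior_Icc] at hu)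
  have hmaps : ∀ a ∈ Ioo t₁ t₂, e a ∈ Ioo (e t₂) (e t₁) := fun a ha =>
    ⟨heanti ⟨ha.1.le, ha.2.le⟩ ⟨h12.le, le_rfl⟩ ha.2,
      heanti ⟨le_rfl, h12.le⟩ ⟨ha.1.le, ha.2.le⟩ ha.1⟩
  have hleft : ∀ a ∈ Ioo t₁ t₂, aTime e (e a) = a := fun a ha =>
    heanti.injOn (hinv _ (hmaps a ha)).1 (Ioo_subset_Icc_self ha) (hinv _ (hmaps a ha)).2
  have hmem : ∀ μ ∈ Ioo (e t₂) (e t₁), aTime e μ ∈ Ioo t₁ t₂ := by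
    intro μ hμ
    obtain ⟨⟨h1, h2⟩, h3⟩ := hinv μ hμ
    refine ⟨lt_of_le_of_ne h1 fun h => ?_, lt_of_le_of_ne h2 fun h => ?_⟩
    · rw [← h] at h3
      exact hμ.2.ne' h3
    · rw [h] at h3
      exact hμ.1.ne h3
  have hpos : 0 < min (s - t₁) (t₂ - s) := lt_min (sub_pos.2 hs.1) (sub_pos.2 hs.2)
  constructor
  · refine ⟨min (s - t₁) (t₂ - s) / 2, half_pos hpos, fun h h0 hh => ?_⟩
    obtain ⟨hh₁, hh₂⟩ := lt_min_iff.1 (hh.trans_lt (half_lt_self hpos))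
    obtain ⟨a, ha, hamin⟩ := exists_increment_minimizer he hs hmax hmono heanti h0 hh₁ hh₂
    obtain ⟨hlt, hcrit, -, -⟩ :=
      increment_minimizer_spec he hs hmax hanti hmono heanti h0 hh₁ ha hamin
    refine ⟨e a, hmaps a ha, ?_⟩
    rw [hleft a ha]
    refine ⟨fun μ hμ => ?_, ⟨hlt, ha.2⟩, hcrit, rfl⟩
    have := hamin _ (hmem μ hμ)
    rwa [(hinv μ hμ).2] at this
  · intro ε hε
    obtain ⟨δ, hδ, hcont⟩ := Metric.continuous_iff.1 he.continuous s ε hε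
    refine ⟨min δ (s - t₁), lt_min hδ (sub_pos.2 hs.1), fun h h0 hh μ hμ hμmin => ?_⟩
    obtain ⟨hhδ, hh₁⟩ := lt_min_iff.1 hh
    obtain ⟨-, -, hsa, has⟩ :=
      increment_minimizer_spec he hs hmax hanti hmono heanti h0 hh₁ (hmem μ hμ)
        fun b hb => by
          have := hμmin _ (hmaps b hb)
          rw [hleft b hb] at this
          rwa [(hinv μ hμ).2]
    have := hcont (aTime e μ) (by rw [Real.dist_eq, abs_lt]; constructor <;> linarith)
    rwa [(hinv μ hμ).2, Real.dist_eq] at this
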